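/- arXiv:2012.03018 — 5 statements merged into one kernel-verified Lean document; each statement's English description precedes it below -/
import Mathlib

section
/- Let n ≥ 1, let U ⊆ ℂⁿ be open, let φ : U → ℝ be twice continuously differentiable, and define g : U × ℂ → ℝ by g(z, w) = |w|² − exp(φ(z)). Then g is twice continuously differentiable and for every point p = (z, w) ∈ U × ℂ and every vector (u, c) ∈ ℂⁿ × ℂ, the complex Hessian of g satisfies H_g(p)(u, c) = −exp(φ(z))·(H_φ(z)(u) + |∂φ(z)(u)|²) + |c|². -/
open Complex

/-- The complex Hessian quadratic form of `f` at `p` evaluated on `v`: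
`H_f(p)(v) = (1/4) * (D²f(p)(v,v) + D²f(p)(iv,iv))`. -/
noncomputable def cHess {E : Type*} [NormedAddCommGroup E] [NormedSpace ℂ E]
    (f : E → ℝ) (p v : E) : ℝ :=
  (1 / 4) * (fderiv ℝ (fderiv ℝ f) p v v + fderiv ℝ (fderiv ℝ f) p (I • v) (I • v))

/-- The (1,0)-differential of `f` at `p` applied to `v`:
`∂f(p)(v) = (1/2) * (Df(p)(v) - i·Df(p)(iv))`. -/
noncomputable def del10 {E : Type*} [NormedAddCommGroup E] [NormedSpace ℂ E]
    (f : E → ℝ) (p v : E) : ℂ :=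
  (1 / 2) * (((fderiv ℝ f p v : ℝ) : ℂ) - I * ((fderiv ℝ f p (I • v) : ℝ) : ℂ))

section HandleDefiningFunction

variable {E : Type*} [NormedAddCommGroup E] [NormedSpace ℂ E]

/-- The real derivative of `(z, w) ↦ ‖w‖ ^ 2 - exp (φ z)`. -/
theorem hasFDerivAt_norm_sq_snd_sub_exp_fst {φ : E → ℝ} {q : E × ℂ}
    (hφ : DifferentiableAt ℝ φ q.1) :
    HasFDerivAt (fun q : E × ℂ => ‖q.2‖ ^ 2 - Real.exp (φ q.1))
      ((2 : ℝ) • (innerSL ℝ q.2).comp (ContinuousLinearMap.snd ℝ E ℂ) -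
        Real.exp (φ q.1) • (fderiv ℝ φ q.1).comp (ContinuousLinearMap.fst ℝ E ℂ)) q := by
  have h1 : HasFDerivAt (fun q : E × ℂ => ‖q.2‖ ^ 2) _ q :=
    (hasStrictFDerivAt_norm_sq q.2).hasFDerivAt.comp q hasFDerivAt_snd
  have h2 : HasFDerivAt (fun q : E × ℂ => φ q.1) _ q := hφ.hasFDerivAt.comp q hasFDerivAt_fst
  refine (h1.sub h2.exp).congr_fderiv ?_
  ext <;> simp
  ring

/-- The second real derivative of `(z, w) ↦ ‖w‖ ^ 2 - exp (φ z)` on the diagonal. -/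
theorem fderiv_fderiv_norm_sq_snd_sub_exp_fst {φ : E → ℝ} {z : E} (hφ : ContDiffAt ℝ 2 φ z)
    (w : ℂ) (u : E) (c : ℂ) :
    fderiv ℝ (fderiv ℝ fun q : E × ℂ => ‖q.2‖ ^ 2 - Real.exp (φ q.1)) (z, w) (u, c) (u, c) =
      2 * ‖c‖ ^ 2 -
        Real.exp (φ z) * (fderiv ℝ (fderiv ℝ φ) z u u + fderiv ℝ φ z u ^ 2) := by
  have hev : ∀ᶠ x in nhds z, DifferentiableAt ℝ φ x :=
    (hφ.eventually (by simp)).mono fun x hx => hx.differentiableAt (by simp)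
  have hev' : ∀ᶠ q in nhds ((z, w) : E × ℂ), DifferentiableAt ℝ φ q.1 :=
    (continuous_fst.tendsto (z, w)).eventually hev
  rw [Filter.EventuallyEq.fderiv_eq
    (hev'.mono fun q hq => (hasFDerivAt_norm_sq_snd_sub_exp_fst hq).fderiv)]
  have hd : DifferentiableAt ℝ (fderiv ℝ φ) z :=
    (hφ.fderiv_right (m := 1) (by norm_num)).differentiableAt (by simp)
  have h2 : HasFDerivAt (fun q : E × ℂ => φ q.1) _ (z, w) :=
    hev.self_of_nhds.hasFDerivAt.comp (z, w) hasFDerivAt_fst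
  have h3 : HasFDerivAt (fun q : E × ℂ => fderiv ℝ φ q.1) _ (z, w) :=
    hd.hasFDerivAt.comp (z, w) hasFDerivAt_fst
  have h4 : HasFDerivAt (fun q : E × ℂ => innerSL ℝ q.2) _ (z, w) :=
    (innerSL ℝ (E := ℂ)).hasFDerivAt.comp (z, w) hasFDerivAt_snd
  have h5 := ((h4.clm_comp (hasFDerivAt_const (ContinuousLinearMap.snd ℝ E ℂ) _)).const_smul
    (2 : ℝ)).sub
    (h2.exp.smul (h3.clm_comp (hasFDerivAt_const (ContinuousLinearMap.fst ℝ E ℂ) _)))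
  refine (congrArg (fun L => L (u, c) (u, c)) h5.fderiv).trans ?_
  have hc : innerSL ℝ c c = ‖c‖ ^ 2 := real_inner_self_eq_norm_sq c
  simp [hc]
  ring

/-- The complex Hessian of `(z, w) ↦ ‖w‖ ^ 2 - exp (φ z)`. -/
theorem cHess_norm_sq_snd_sub_exp_fst {φ : E → ℝ} {z : E} (hφ : ContDiffAt ℝ 2 φ z)
    (w : ℂ) (u : E) (c : ℂ) :
    cHess (fun q : E × ℂ => ‖q.2‖ ^ 2 - Real.exp (φ q.1)) (z, w) (u, c) =
      -Real.exp (φ z) * (cHess φ z u + ‖del10 φ z u‖ ^ 2) + ‖c‖ ^ 2 := by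
  have hnorm : ‖del10 φ z u‖ ^ 2 = (1 / 4) * (fderiv ℝ φ z u ^ 2 + fderiv ℝ φ z (I • u) ^ 2) := by
    rw [← Complex.normSq_eq_norm_sq, del10, map_mul, Complex.normSq_apply, Complex.normSq_apply]
    simp
    ring
  have h1 := fderiv_fderiv_norm_sq_snd_sub_exp_fst hφ w u c
  have h2 := fderiv_fderiv_norm_sq_snd_sub_exp_fst hφ w (I • u) (I • c)
  have hc : ‖I • c‖ = ‖c‖ := by simp
  rw [hc] at h2
  rw [hnorm, cHess, cHess, Prod.smul_mk]
  linear_combination (1 / 4) * h1 + (1 / 4) * h2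

end HandleDefiningFunction

/-- complex Hessian of `g(z,w) = |w|² - exp(φ(z))`. -/
theorem hessian_of_handle_defining_function
    (n : ℕ) (hn : 1 ≤ n) (U : Set (EuclideanSpace ℂ (Fin n))) (hU : IsOpen U)
    (φ : EuclideanSpace ℂ (Fin n) → ℝ) (hφ : ContDiffOn ℝ 2 φ U)
    (g : EuclideanSpace ℂ (Fin n) × ℂ → ℝ)
    (hg : ∀ z w, g (z, w) = ‖w‖ ^ 2 - Real.exp (φ z)) :
    ContDiffOn ℝ 2 g (U ×ˢ Set.univ) ∧
      ∀ z ∈ U, ∀ (w : ℂ) (u : EuclideanSpace ℂ (Fin n)) (c : ℂ),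
        cHess g (z, w) (u, c) =
          -Real.exp (φ z) * (cHess φ z u + ‖del10 φ z u‖ ^ 2) + ‖c‖ ^ 2 := by
  obtain rfl : g = fun q => ‖q.2‖ ^ 2 - Real.exp (φ q.1) := funext fun q => hg q.1 q.2
  refine ⟨?_, fun z hz w u c =>
    cHess_norm_sq_snd_sub_exp_fst (hφ.contDiffAt (hU.mem_nhds hz)) w u c⟩
  exact (contDiff_snd.norm_sq ℝ).contDiffOn.sub
    (hφ.comp contDiff_fst.contDiffOn fun q hq => hq.1).exp
end

section
/- Let n ≥ 1, let U ⊆ ℂⁿ be open, let φ : U → ℝ be twice continuously differentiable and strictly plurisubharmonic on U, and define g : U × ℂ → ℝ by g(z, w) = |w|² − exp(φ(z)). Then for every point p = (z, w) ∈ U × ℂ with |w|² = exp(φ(z)), and for every nonzero vector (u, c) ∈ ℂⁿ × ℂ satisfying −exp(φ(z))·∂φ(z)(u) + w̄·c = 0, one has H_g(p)(u, c) < 0. (That is, the Levi form of the boundary hypersurface {|w|² = exp(φ(z))} is negative definite on its holomorphic tangent spaces, so the hypersurface is strongly pseudoconcave.) -/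
open Complex

section

variable {E : Type*} [NormedAddCommGroup E] [NormedSpace ℂ E]

/-- The squared modulus of the (1,0)-differential. -/
lemma norm_sq_del10 (f : E → ℝ) (p v : E) :
    ‖del10 f p v‖ ^ 2 = (1 / 4) * ((fderiv ℝ f p v) ^ 2 + (fderiv ℝ f p (I • v)) ^ 2) := by
  rw [← Complex.normSq_eq_norm_sq, del10, Complex.normSq_mul, Complex.normSq_apply,
    Complex.normSq_apply]
  simp
  ring

/-- The real derivative of `(z, w) ↦ ‖w‖² - exp (φ z)`. -/
lemma hasFDerivAt_norm_sq_sub_exp {φ : E → ℝ} {p : E × ℂ} (hφ : DifferentiableAt ℝ φ p.1) :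
    HasFDerivAt (fun q : E × ℂ => ‖q.2‖ ^ 2 - Real.exp (φ q.1))
      (((2 : ℝ) • innerSL ℝ p.2).comp (ContinuousLinearMap.snd ℝ E ℂ) -
        Real.exp (φ p.1) • (fderiv ℝ φ p.1).comp (ContinuousLinearMap.fst ℝ E ℂ)) p := by
  have h1 : HasFDerivAt (fun q : E × ℂ => ‖q.2‖ ^ 2)
      (((2 : ℝ) • innerSL ℝ p.2).comp (ContinuousLinearMap.snd ℝ E ℂ)) p := by
    have := (hasStrictFDerivAt_norm_sq p.2).hasFDerivAt.comp p
      (ContinuousLinearMap.snd ℝ E ℂ).hasFDerivAt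
    refine this.congr_fderiv ?_
    ext v <;> simp [two_mul]
    ring
  exact h1.sub (hφ.hasFDerivAt.comp p (ContinuousLinearMap.fst ℝ E ℂ).hasFDerivAt).exp

/-- The second real derivative of `(z, w) ↦ ‖w‖² - exp (φ z)` on the diagonal. -/
lemma fderiv_fderiv_norm_sq_sub_exp {φ : E → ℝ} {p : E × ℂ} (hφ : ContDiffAt ℝ 2 φ p.1)
    (v : E × ℂ) :
    fderiv ℝ (fderiv ℝ (fun q : E × ℂ => ‖q.2‖ ^ 2 - Real.exp (φ q.1))) p v v =
      2 * ‖v.2‖ ^ 2 - Real.exp (φ p.1) *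
        (fderiv ℝ (fderiv ℝ φ) p.1 v.1 v.1 + (fderiv ℝ φ p.1 v.1) ^ 2) := by
  have hev : ∀ᶠ q : E × ℂ in nhds p, DifferentiableAt ℝ φ q.1 := by
    have h := hφ.eventually (by simp)
    exact (continuous_fst.tendsto p).eventually
      (h.mono fun x hx => hx.differentiableAt (by simp))
  have hd : HasFDerivAt φ (fderiv ℝ φ p.1) p.1 :=
    (hφ.differentiableAt (by simp)).hasFDerivAt
  have hd2 : HasFDerivAt (fderiv ℝ φ) (fderiv ℝ (fderiv ℝ φ) p.1) p.1 :=
    ((hφ.fderiv_right (m := 1) (by norm_num)).differentiableAt (by simp)).hasFDerivAt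
  have hfst : HasFDerivAt (fun q : E × ℂ => q.1) (ContinuousLinearMap.fst ℝ E ℂ) p :=
    hasFDerivAt_fst
  have hsnd : HasFDerivAt (fun q : E × ℂ => q.2) (ContinuousLinearMap.snd ℝ E ℂ) p :=
    hasFDerivAt_snd
  have hexp := (hd.comp p hfst).exp
  have hA := ((innerSL ℝ (E := ℂ)).hasFDerivAt.comp p hsnd).const_smul (2 : ℝ)
  have hA' := hA.clm_comp (hasFDerivAt_const (ContinuousLinearMap.snd ℝ E ℂ) p)
  have hB := hexp.smul ((hd2.comp p hfst).clm_comp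
    (hasFDerivAt_const (ContinuousLinearMap.fst ℝ E ℂ) p))
  have key := (hA'.sub hB).congr_of_eventuallyEq
    (hev.mono fun q hq => (hasFDerivAt_norm_sq_sub_exp hq).fderiv)
  have hinner : innerSL ℝ v.2 v.2 = ‖v.2‖ ^ 2 := real_inner_self_eq_norm_sq v.2
  rw [key.fderiv]
  simp [hinner]
  ring

/-- The complex Hessian of `(z, w) ↦ ‖w‖² - exp (φ z)`. -/
lemma cHess_norm_sq_sub_exp {φ : E → ℝ} {z : E} (hφ : ContDiffAt ℝ 2 φ z) (w : ℂ)
    (u : E) (c : ℂ) :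
    cHess (fun q : E × ℂ => ‖q.2‖ ^ 2 - Real.exp (φ q.1)) (z, w) (u, c) =
      ‖c‖ ^ 2 - Real.exp (φ z) * (cHess φ z u + ‖del10 φ z u‖ ^ 2) := by
  have h1 := fderiv_fderiv_norm_sq_sub_exp (p := (z, w)) hφ (u, c)
  have h2 := fderiv_fderiv_norm_sq_sub_exp (p := (z, w)) hφ (I • (u, c))
  rw [norm_sq_del10, cHess, cHess]
  erw [h1, h2]
  simp
  ring

end

/-- if `φ` is strictly plurisubharmonic, then the Levi form of the
hypersurface `{|w|² = exp(φ(z))}` is negative definite on the holomorphic tangent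
spaces, i.e. the hypersurface is strongly pseudoconcave. -/
theorem boundary_strongly_pseudoconcave
    (n : ℕ) (hn : 1 ≤ n) (U : Set (EuclideanSpace ℂ (Fin n))) (hU : IsOpen U)
    (φ : EuclideanSpace ℂ (Fin n) → ℝ) (hφ : ContDiffOn ℝ 2 φ U)
    (hpsh : ∀ p ∈ U, ∀ v : EuclideanSpace ℂ (Fin n), v ≠ 0 → 0 < cHess φ p v)
    (g : EuclideanSpace ℂ (Fin n) × ℂ → ℝ)
    (hg : ∀ z w, g (z, w) = ‖w‖ ^ 2 - Real.exp (φ z)) :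
    ∀ z ∈ U, ∀ w : ℂ, ‖w‖ ^ 2 = Real.exp (φ z) →
      ∀ (u : EuclideanSpace ℂ (Fin n)) (c : ℂ), (u, c) ≠ (0, 0) →
        -(Real.exp (φ z) : ℂ) * del10 φ z u + (starRingEnd ℂ) w * c = 0 →
          cHess g (z, w) (u, c) < 0 := by
  intro z hz w hw u c huc htan
  obtain rfl : g = fun q => ‖q.2‖ ^ 2 - Real.exp (φ q.1) := funext fun q => hg q.1 q.2
  rw [cHess_norm_sq_sub_exp (hφ.contDiffAt (hU.mem_nhds hz))]
  have hpos := Real.exp_pos (φ z)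
  have heq : (starRingEnd ℂ) w * c = (Real.exp (φ z) : ℂ) * del10 φ z u := by
    linear_combination htan
  have hnorm : ‖c‖ ^ 2 = Real.exp (φ z) * ‖del10 φ z u‖ ^ 2 := by
    have h := congrArg (fun x : ℂ => ‖x‖ ^ 2) heq
    simp only [norm_mul, mul_pow, RCLike.norm_conj, Complex.norm_real, Real.norm_eq_abs,
      sq_abs, hw] at h
    exact mul_left_cancel₀ hpos.ne' (by rw [h]; ring)
  have hu : u ≠ 0 := by
    rintro rfl
    have hc : c = 0 := by simpa [del10] using hnorm
    exact huc (by rw [hc])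
  have := mul_pos hpos (hpsh z hz u hu)
  rw [hnorm]
  linarith
end

section
/- Let n ≥ 1, let U ⊆ ℂⁿ be open, let φ : U → ℝ be twice continuously differentiable, and define g : U × ℂ → ℝ by g(z, w) = |w|² − exp(φ(z)). Suppose that for every point p = (z, w) ∈ U × ℂ with |w|² = exp(φ(z)) and every nonzero vector (u, c) ∈ ℂⁿ × ℂ satisfying −exp(φ(z))·∂φ(z)(u) + w̄·c = 0, one has H_g(p)(u, c) < 0. Then φ is strictly plurisubharmonic on U. -/
open Complex

/-- The second derivative of `(z, w) ↦ ‖w‖² - exp (φ z)` along `(u, c)`. -/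
lemma fderiv_fderiv_normSq_sub_exp {E F : Type*} [NormedAddCommGroup E] [NormedSpace ℝ E]
    [NormedAddCommGroup F] [InnerProductSpace ℝ F]
    {φ : E → ℝ} {z : E} (hφ : ContDiffAt ℝ 2 φ z) (w : F) (u : E) (c : F) :
    fderiv ℝ (fderiv ℝ fun q : E × F => ‖q.2‖ ^ 2 - Real.exp (φ q.1)) (z, w) (u, c) (u, c) =
      2 * ‖c‖ ^ 2 -
        Real.exp (φ z) * ((fderiv ℝ φ z u) ^ 2 + fderiv ℝ (fderiv ℝ φ) z u u) := by
  set g : E × F → ℝ := fun q => ‖q.2‖ ^ 2 - Real.exp (φ q.1) with hg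
  have hφ_fst : ContDiffAt ℝ 2 (fun q : E × F => φ q.1) (z, w) :=
    ContDiffAt.comp (z, w) (g := φ) hφ contDiffAt_fst
  have hgC : ContDiffAt ℝ 2 g (z, w) := (contDiffAt_snd.norm_sq ℝ).sub hφ_fst.exp
  have hg_diff : DifferentiableAt ℝ (fderiv ℝ g) (z, w) :=
    (hgC.fderiv_right (m := 1) (by norm_num)).differentiableAt (by norm_num)
  have hφ_diff : DifferentiableAt ℝ (fderiv ℝ φ) z :=
    (hφ.fderiv_right (m := 1) (by norm_num)).differentiableAt (by norm_num)
  have hφ_near : ∀ᶠ q : E × F in nhds (z, w), DifferentiableAt ℝ φ q.1 := by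
    have h : ∀ᶠ x in nhds z, DifferentiableAt ℝ φ x :=
      (hφ.eventually (by simp)).mono fun x hx => hx.differentiableAt (by norm_num)
    exact continuousAt_fst.eventually h
  have hfirst : (fun q => fderiv ℝ g q (u, c)) =ᶠ[nhds (z, w)]
      fun q => 2 * inner ℝ q.2 c - Real.exp (φ q.1) * fderiv ℝ φ q.1 u := by
    filter_upwards [hφ_near] with q hq
    have h₁ : HasFDerivAt (𝕜 := ℝ) (fun q : E × F => φ q.1) _ q :=
      HasFDerivAt.comp q (g := φ) hq.hasFDerivAt hasFDerivAt_fst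
    have h₂ : HasFDerivAt (𝕜 := ℝ) (fun q : E × F => q.2) _ q := hasFDerivAt_snd (𝕜 := ℝ)
    have h₃ : HasFDerivAt (𝕜 := ℝ) g _ q := h₂.norm_sq.sub h₁.exp
    rw [h₃.fderiv]
    simp
  have h₁ : HasFDerivAt (𝕜 := ℝ) (fun q : E × F => φ q.1) _ (z, w) :=
    HasFDerivAt.comp (z, w) (g := φ)
      (hφ.differentiableAt (by norm_num)).hasFDerivAt hasFDerivAt_fst
  have h₂ : HasFDerivAt (𝕜 := ℝ) (fun q : E × F => fderiv ℝ φ q.1) _ (z, w) :=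
    HasFDerivAt.comp (z, w) (g := fderiv ℝ φ) hφ_diff.hasFDerivAt hasFDerivAt_fst
  have h₃ : HasFDerivAt (𝕜 := ℝ) (fun q : E × F => q.2) _ (z, w) := hasFDerivAt_snd (𝕜 := ℝ)
  have hsecond : HasFDerivAt (𝕜 := ℝ) (fun q : E × F =>
      2 * inner ℝ q.2 c - Real.exp (φ q.1) * fderiv ℝ φ q.1 u) _ (z, w) :=
    ((h₃.inner ℝ (hasFDerivAt_const c (z, w))).const_mul 2).sub
      (h₁.exp.mul (h₂.clm_apply (hasFDerivAt_const u (z, w))))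
  have heval := (hg_diff.hasFDerivAt.clm_apply (hasFDerivAt_const (u, c) (z, w))).fderiv
  rw [hfirst.fderiv_eq, hsecond.fderiv] at heval
  have h := DFunLike.congr_fun heval (u, c)
  simp at h
  rw [← h]
  ring

/-- if the Levi form of the hypersurface `{|w|² = exp(φ(z))}` is negative
definite on holomorphic tangent spaces, then `φ` is strictly plurisubharmonic. -/
theorem strictly_psh_of_boundary_pseudoconcave
    (n : ℕ) (hn : 1 ≤ n) (U : Set (EuclideanSpace ℂ (Fin n))) (hU : IsOpen U)
    (φ : EuclideanSpace ℂ (Fin n) → ℝ) (hφ : ContDiffOn ℝ 2 φ U)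
    (g : EuclideanSpace ℂ (Fin n) × ℂ → ℝ)
    (hg : ∀ z w, g (z, w) = ‖w‖ ^ 2 - Real.exp (φ z))
    (hconc : ∀ z ∈ U, ∀ w : ℂ, ‖w‖ ^ 2 = Real.exp (φ z) →
      ∀ (u : EuclideanSpace ℂ (Fin n)) (c : ℂ), (u, c) ≠ (0, 0) →
        -(Real.exp (φ z) : ℂ) * del10 φ z u + (starRingEnd ℂ) w * c = 0 →
          cHess g (z, w) (u, c) < 0) :
    ∀ p ∈ U, ∀ v : EuclideanSpace ℂ (Fin n), v ≠ 0 → 0 < cHess φ p v := by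
  intro p hp v hv
  obtain rfl : g = fun q => ‖q.2‖ ^ 2 - Real.exp (φ q.1) := funext fun q => hg q.1 q.2
  have hφp : ContDiffAt ℝ 2 φ p := hφ.contDiffAt (hU.mem_nhds hp)
  set r : ℝ := Real.exp (φ p / 2) with hr
  have hr_sq : r ^ 2 = Real.exp (φ p) := by
    rw [hr, ← Real.exp_nat_mul]
    congr 1
    push_cast
    ring
  have hneg := hconc p hp r (by simp [hr_sq]) v (r * del10 φ p v) (by simp [hv]) (by
    rw [← hr_sq, conj_ofReal]
    push_cast
    ring)
  have hnorm : ‖del10 φ p v‖ ^ 2 =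
      (1 / 4) * ((fderiv ℝ φ p v) ^ 2 + (fderiv ℝ φ p (I • v)) ^ 2) := by
    rw [Complex.sq_norm, normSq_apply]
    simp [del10]
    ring
  have hc : ‖(r : ℂ) * del10 φ p v‖ ^ 2 = Real.exp (φ p) * ‖del10 φ p v‖ ^ 2 := by
    rw [norm_mul, mul_pow, norm_real, Real.norm_eq_abs, sq_abs, hr_sq]
  have hIc : ‖I • ((r : ℂ) * del10 φ p v)‖ = ‖(r : ℂ) * del10 φ p v‖ := by
    rw [norm_smul, norm_I, one_mul]
  rw [cHess, Prod.smul_mk, fderiv_fderiv_normSq_sub_exp hφp, fderiv_fderiv_normSq_sub_exp hφp,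
    hIc, hc, hnorm] at hneg
  have hmul : 0 < Real.exp (φ p) * cHess φ p v := by
    rw [cHess]
    linarith
  exact pos_of_mul_pos_right hmul (Real.exp_pos _).le
end

section
/- Let a > 0 and let z₁, z₂ ∈ ℂ satisfy 0 < |z₂| ≤ exp(|z₁|²/a − a). Then there exists a unique real number c ≥ a such that |z₂| = exp(|z₁|²/c − c). (Thus the family of hypersurfaces S_c = {(z₁, z₂) ∈ ℂ² : |z₂| = exp(|z₁|²/c − c)}, c ≥ a, foliates the set Ω_a − E, where Ω_a = {(z₁, z₂) : |z₂| ≤ exp(|z₁|²/a − a)} and E = {z₂ = 0}.) -/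
/-- For `r ≥ 0`, the function `c ↦ r / c - c` takes every value `L ≤ r / a - a` exactly once
on `[a, ∞)`. -/
theorem existsUnique_eq_div_sub_self {a r L : ℝ} (ha : 0 < a) (hr : 0 ≤ r)
    (hL : L ≤ r / a - a) : ∃! c : ℝ, a ≤ c ∧ L = r / c - c := by
  have key : L * a + a ^ 2 ≤ r := by
    have h : (L + a) * a ≤ r := (le_div_iff₀ ha).1 (by linarith)
    nlinarith
  have hs : (√(L ^ 2 + 4 * r)) ^ 2 = L ^ 2 + 4 * r := Real.sq_sqrt (by positivity)
  have hle : 2 * a + L ≤ √(L ^ 2 + 4 * r) := Real.le_sqrt_of_sq_le (by nlinarith)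
  have hac : a ≤ (√(L ^ 2 + 4 * r) - L) / 2 := by linarith
  refine ⟨(√(L ^ 2 + 4 * r) - L) / 2, ⟨hac, ?_⟩, ?_⟩
  · rw [eq_sub_iff_add_eq, eq_div_iff (ha.trans_le hac).ne']
    nlinarith
  · rintro c ⟨hc, h⟩
    have hc0 : 0 < c := ha.trans_le hc
    rw [eq_sub_iff_add_eq, eq_div_iff hc0.ne'] at h
    have h2 : √(L ^ 2 + 4 * r) = 2 * c + L := by
      rw [show L ^ 2 + 4 * r = (2 * c + L) ^ 2 by rw [← h]; ring]
      refine Real.sqrt_sq ?_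
      have : 0 ≤ L + c := nonneg_of_mul_nonneg_left (h ▸ hr) hc0
      linarith
    linarith

/-- for `a > 0` and `(z₁, z₂)` in `Ω_a − E`, there is a unique `c ≥ a`
with `|z₂| = exp(|z₁|²/c − c)`; the hypersurfaces `S_c` foliate `Ω_a − E`. -/
theorem foliation_of_handle_complement (a : ℝ) (ha : 0 < a) (z₁ z₂ : ℂ)
    (hz₂ : 0 < ‖z₂‖) (hΩ : ‖z₂‖ ≤ Real.exp (‖z₁‖ ^ 2 / a - a)) :
    ∃! c : ℝ, a ≤ c ∧ ‖z₂‖ = Real.exp (‖z₁‖ ^ 2 / c - c) := by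
  rw [← Real.exp_log hz₂] at hΩ ⊢
  simpa only [Real.exp_eq_exp] using
    existsUnique_eq_div_sub_self ha (sq_nonneg ‖z₁‖) (Real.exp_le_exp.1 hΩ)
end

section
/- Let z ∈ ℂ with |z| = 1, let x ∈ ℝ, and let n ∈ ℤ. Let W ⊆ ℂ² be the real linear span (ℝ-submodule) of the two vectors (iz, i·n·x·zⁿ) and (0, zⁿ). If v ∈ W and i·v ∈ W, then v = 0. (That is, the image of the annulus under the embedding g_n(z, x) = (z, x·zⁿ) is a totally real submanifold of ℂ².) -/
open Complex

/-- the tangent planes of the image of the annulus under the embedding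
`g_n(z, x) = (z, x·zⁿ)`, spanned over `ℝ` by `(iz, i·n·x·zⁿ)` and `(0, zⁿ)` with
`|z| = 1`, are totally real. -/
theorem twisted_annulus_totally_real (z : ℂ) (hz : ‖z‖ = 1) (x : ℝ) (n : ℤ)
    (v : ℂ × ℂ)
    (hv : v ∈ Submodule.span ℝ
      ({(I * z, I * (n : ℂ) * (x : ℂ) * z ^ n), (0, z ^ n)} : Set (ℂ × ℂ)))
    (hiv : I • v ∈ Submodule.span ℝ
      ({(I * z, I * (n : ℂ) * (x : ℂ) * z ^ n), (0, z ^ n)} : Set (ℂ × ℂ))) :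
    v = 0 := by
  have real_of_I_mul {a c : ℝ} {w : ℂ} (hw : w ≠ 0) (h : c * w = I * (a * w)) :
      a = 0 ∧ c = 0 := by
    have h' : (c : ℂ) = I * a := mul_right_cancel₀ hw (by rw [h, mul_assoc])
    have hre := congrArg Complex.re h'
    have him := congrArg Complex.im h'
    simp at hre him
    exact ⟨him.symm, hre⟩
  have hz0 : z ≠ 0 := norm_ne_zero_iff.mp (by rw [hz]; exact one_ne_zero)
  obtain ⟨a, b, rfl⟩ := Submodule.mem_span_pair.mp hv
  obtain ⟨c, d, h⟩ := Submodule.mem_span_pair.mp hiv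
  have h₁ := congrArg Prod.fst h
  have h₂ := congrArg Prod.snd h
  simp only [Prod.fst_add, Prod.snd_add, Prod.smul_fst, Prod.smul_snd, real_smul, smul_eq_mul,
    mul_zero, add_zero] at h₁ h₂
  obtain ⟨rfl, rfl⟩ := real_of_I_mul (mul_ne_zero I_ne_zero hz0) h₁
  simp only [ofReal_zero, zero_mul, zero_add] at h₂
  obtain ⟨rfl, rfl⟩ := real_of_I_mul (zpow_ne_zero n hz0) h₂
  simp
end
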